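/- Let G decompose as a finite graph of groups such that (1) each vertex group G_v is finitely generated, undistorted in G, and every strongly quasiconvex infinite subgroup of G_v has finite index in G_v, and (2) each edge group is infinite. If H is a strongly quasiconvex subgroup of G of infinite index, then gHg^{-1} ∩ G_v is finite for every vertex group G_v and every g ∈ G. -/

import Mathlib

open Set

namespace Paper

/-- Word metric distance with respect to a (symmetrized) generating set `S`. -/
noncomputable def wordDist {G : Type*} [Group G] (S : Set G) (g h : G) : ℕ :=
  sInf {n | ∃ w : List G, w.length = n ∧ (∀ x ∈ w, x ∈ S ∨ x⁻¹ ∈ S) ∧ g⁻¹ * h = w.prod}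

/-- A discrete `(K, C)`-quasi-geodesic in the word metric. -/
def IsQuasiGeodesic {G : Type*} [Group G] (S : Set G) (K C : ℝ) {n : ℕ}
    (q : Fin (n + 1) → G) : Prop :=
  ∀ i j : Fin (n + 1),
    (wordDist S (q i) (q j) : ℝ) ≤ K * |((i : ℕ) : ℝ) - ((j : ℕ) : ℝ)| + C ∧
      |((i : ℕ) : ℝ) - ((j : ℕ) : ℝ)| / K - C ≤ (wordDist S (q i) (q j) : ℝ)

/-- A subset `H` is strongly quasiconvex (Morse) with respect to the word metric of `S`:
every quasi-geodesic with endpoints in `H` stays uniformly close to `H`. -/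
def StronglyQuasiconvex {G : Type*} [Group G] (S : Set G) (H : Set G) : Prop :=
  ∀ K C : ℝ, 1 ≤ K → 0 ≤ C → ∃ M : ℝ, ∀ (n : ℕ) (q : Fin (n + 1) → G),
    q 0 ∈ H → q (Fin.last n) ∈ H → IsQuasiGeodesic S K C q →
      ∀ i, ∃ h ∈ H, (wordDist S (q i) h : ℝ) ≤ M

/-- The subgroup `H` (with generating data `T`) is undistorted in `G` (with generating data `S`):
the inclusion is a quasi-isometric embedding for the word metrics. -/
def Undistorted {G : Type*} [Group G] (S : Set G) (H : Subgroup G) (T : Set H) : Prop :=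
  ∃ K C : ℝ, 1 ≤ K ∧ 0 ≤ C ∧ ∀ a b : H,
    (wordDist T a b : ℝ) ≤ K * (wordDist S (a : G) (b : G)) + C ∧
      (wordDist S (a : G) (b : G) : ℝ) ≤ K * (wordDist T a b) + C

/-- Quasi-isometry between two groups with chosen generating sets. -/
def QuasiIsometric (G : Type*) [Group G] (S : Set G) (H : Type*) [Group H] (T : Set H) :
    Prop :=
  ∃ (φ : G → H) (K C : ℝ), 1 ≤ K ∧ 0 ≤ C ∧
    (∀ a b : G,
      (wordDist T (φ a) (φ b) : ℝ) ≤ K * (wordDist S a b) + C ∧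
        (wordDist S a b : ℝ) ≤ K * (wordDist T (φ a) (φ b)) + C) ∧
    ∀ h : H, ∃ g : G, (wordDist T (φ g) h : ℝ) ≤ C

/-- A group action on a graph by graph automorphisms. -/
def ActsOnGraph (G : Type*) [Group G] {V : Type*} [MulAction G V] (Γ : SimpleGraph V) :
    Prop :=
  ∀ (g : G) (v w : V), Γ.Adj v w → Γ.Adj (g • v) (g • w)

/-- Relators of the right-angled Coxeter group of a graph. -/
def racgRels {V : Type*} (Γ : SimpleGraph V) : Set (FreeGroup V) :=
  {r | ∃ v : V, r = FreeGroup.of v * FreeGroup.of v} ∪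
    {r | ∃ v w : V, Γ.Adj v w ∧ r = (FreeGroup.of v * FreeGroup.of w) ^ 2}

/-- The right-angled Coxeter group of a simplicial graph. -/
abbrev RACG {V : Type*} (Γ : SimpleGraph V) : Type _ := PresentedGroup (racgRels Γ)

/-- The standard (vertex) generating set of a RACG. -/
def racgGen {V : Type*} (Γ : SimpleGraph V) : Set (RACG Γ) :=
  Set.range fun v : V => (PresentedGroup.of v : RACG Γ)

/-- The special subgroup of a RACG generated by a set of vertices. -/
def specialSubgroup {V : Type*} (Γ : SimpleGraph V) (J : Set V) : Subgroup (RACG Γ) :=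
  Subgroup.closure ((fun v : V => (PresentedGroup.of v : RACG Γ)) '' J)

/-- Relators of the right-angled Artin group of a graph. -/
def raagRels {V : Type*} (Γ : SimpleGraph V) : Set (FreeGroup V) :=
  {r | ∃ v w : V, Γ.Adj v w ∧
    r = FreeGroup.of v * FreeGroup.of w * (FreeGroup.of v)⁻¹ * (FreeGroup.of w)⁻¹}

/-- The right-angled Artin group of a simplicial graph. -/
abbrev RAAG {V : Type*} (Γ : SimpleGraph V) : Type _ := PresentedGroup (raagRels Γ)

/-- The standard (vertex) generating set of a RAAG. -/
def raagGen {V : Type*} (Γ : SimpleGraph V) : Set (RAAG Γ) :=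
  Set.range fun v : V => (PresentedGroup.of v : RAAG Γ)

/-- The coned-off Cayley graph of `G` with respect to the generating set `S` and the
peripheral collection `P`. -/
def conedOffCayley (G : Type*) [Group G] (S : Set G) {ι : Type*} (P : ι → Subgroup G) :
    SimpleGraph (G ⊕ Σ i : ι, G ⧸ P i) :=
  SimpleGraph.fromRel fun x y =>
    match x, y with
    | Sum.inl g, Sum.inl h => g⁻¹ * h ∈ S
    | Sum.inl g, Sum.inr ⟨i, c⟩ => (QuotientGroup.mk g : G ⧸ P i) = c
    | _, _ => False

/-- A connected graph is hyperbolic if its path metric satisfies the four-point condition. -/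
def IsHyperbolicGraph {α : Type*} (Γ : SimpleGraph α) : Prop :=
  Γ.Connected ∧ ∃ δ : ℝ, 0 ≤ δ ∧ ∀ x y z w : α,
    (Γ.dist x y : ℝ) + (Γ.dist z w : ℝ) ≤
      max ((Γ.dist x z : ℝ) + (Γ.dist y w : ℝ)) ((Γ.dist x w : ℝ) + (Γ.dist y z : ℝ)) + δ

/-- A graph is fine if each edge lies in only finitely many circuits of each bounded length. -/
def IsFineGraph {α : Type*} (Γ : SimpleGraph α) : Prop :=
  ∀ (n : ℕ) (v w : α), Γ.Adj v w →
    {p : Γ.Walk v v | p.IsCircuit ∧ p.length ≤ n ∧ s(v, w) ∈ p.edges}.Finite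

/-- `G` is hyperbolic relative to the finite collection of subgroups `P`. -/
def RelativelyHyperbolic (G : Type*) [Group G] {ι : Type*} (P : ι → Subgroup G) : Prop :=
  Finite ι ∧ ∃ S : Finset G, Subgroup.closure (S : Set G) = ⊤ ∧
    IsHyperbolicGraph (conedOffCayley G (S : Set G) P) ∧
    IsFineGraph (conedOffCayley G (S : Set G) P)

/-- There is a path from `x` to `y` of length at most `L` in the Cayley graph of `(G,S)`
avoiding the ball of radius `r` about the identity. -/
def PathAvoiding {G : Type*} [Group G] (S : Set G) (r : ℕ) (x y : G) (L : ℕ) : Prop :=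
  ∃ (m : ℕ) (p : Fin (m + 1) → G), p 0 = x ∧ p (Fin.last m) = y ∧ m ≤ L ∧
    (∀ i : Fin m, wordDist S (p i.castSucc) (p i.succ) ≤ 1) ∧
    ∀ i, r ≤ wordDist S 1 (p i)

/-- The divergence of `(G,S)` is bounded above by (a linear function of) `f`. -/
def DivergenceUpperBound (G : Type*) [Group G] (S : Set G) (f : ℕ → ℕ) : Prop :=
  ∃ A B : ℕ, 0 < A ∧ ∀ (n : ℕ) (x y : G), wordDist S 1 x = n → wordDist S 1 y = n →
    PathAvoiding S (n / 2) x y (A * f n + B)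

/-- The divergence of `(G,S)` is bounded below by (a linear function of) `f`. -/
def DivergenceLowerBound (G : Type*) [Group G] (S : Set G) (f : ℕ → ℕ) : Prop :=
  ∃ A B : ℕ, 0 < A ∧ ∀ N : ℕ, ∃ n, N ≤ n ∧ ∃ x y : G,
    wordDist S 1 x = n ∧ wordDist S 1 y = n ∧
    ∀ L : ℕ, PathAvoiding S (n / 2) x y L → f n ≤ A * L + B

def HasLinearDivergence (G : Type*) [Group G] (S : Set G) : Prop :=
  DivergenceUpperBound G S (fun n => n) ∧ DivergenceLowerBound G S (fun n => n)

def HasQuadraticDivergence (G : Type*) [Group G] (S : Set G) : Prop :=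
  DivergenceUpperBound G S (fun n => n ^ 2) ∧ DivergenceLowerBound G S (fun n => n ^ 2)

def HasExponentialDivergence (G : Type*) [Group G] (S : Set G) : Prop :=
  (∃ b : ℕ, 2 ≤ b ∧ DivergenceUpperBound G S (fun n => b ^ n)) ∧
    DivergenceLowerBound G S (fun n => 2 ^ n)

/-- `c` parametrizes an induced 4-cycle of `Γ`. -/
def IsInducedFourCycle {V : Type*} (Γ : SimpleGraph V) (c : Fin 4 → V) : Prop :=
  Function.Injective c ∧ ∀ i j : Fin 4, Γ.Adj (c i) (c j) ↔ (j = i + 1 ∨ i = j + 1)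

/-- `s` is the vertex set of an induced 4-cycle of `Γ`. -/
def IsFourCycleSet {V : Type*} (Γ : SimpleGraph V) (s : Set V) : Prop :=
  ∃ c : Fin 4 → V, IsInducedFourCycle Γ c ∧ Set.range c = s

/-- The four-cycle graph `Γ⁴`: vertices are the induced 4-cycles of `Γ`, adjacent when the
corresponding 4-cycles share a pair of non-adjacent vertices. -/
def fourCycleGraph {V : Type*} (Γ : SimpleGraph V) :
    SimpleGraph {s : Set V // IsFourCycleSet Γ s} :=
  SimpleGraph.fromRel fun s t =>
    ∃ a b : V, a ≠ b ∧ ¬ Γ.Adj a b ∧ a ∈ s.1 ∩ t.1 ∧ b ∈ s.1 ∩ t.1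

/-- `Γ` is CFS: `Γ = Ω * K` with `K` a (possibly empty) clique and `Ω` nonempty such that
`Ω⁴` has a connected component whose support is all of `V(Ω)`. -/
def CFS {V : Type*} (Γ : SimpleGraph V) : Prop :=
  ∃ Ω K : Set V, Ω ∪ K = Set.univ ∧ Disjoint Ω K ∧ Ω.Nonempty ∧
    (∀ a ∈ K, ∀ b ∈ K, a ≠ b → Γ.Adj a b) ∧
    (∀ a ∈ Ω, ∀ b ∈ K, Γ.Adj a b) ∧
    ∃ s₀ : {s : Set ↥Ω // IsFourCycleSet (Γ.induce Ω) s},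
      ∀ v : ↥Ω, ∃ t : {s : Set ↥Ω // IsFourCycleSet (Γ.induce Ω) s},
        (fourCycleGraph (Γ.induce Ω)).Reachable s₀ t ∧ v ∈ t.1

/-- A (topological) planar embedding of the graph `Γ`: vertices go to distinct points of the
plane, each edge to an arc between the images of its endpoints, arcs meeting only at common
endpoint vertices. -/
structure PlanarEmbedding {V : Type*} (Γ : SimpleGraph V) where
  vmap : V → ℝ × ℝ
  inj : Function.Injective vmap
  emap : Sym2 V → Set (ℝ × ℝ)
  arc : ∀ ⦃u v : V⦄, Γ.Adj u v → ∃ γ : Path (vmap u) (vmap v),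
    Function.Injective (⇑γ) ∧ Set.range (⇑γ) = emap s(u, v)
  disjointEdges : ∀ e ∈ Γ.edgeSet, ∀ e' ∈ Γ.edgeSet, e ≠ e' →
    emap e ∩ emap e' ⊆ Set.range vmap
  vertexOnEdge : ∀ e ∈ Γ.edgeSet, ∀ v : V, vmap v ∈ emap e → v ∈ e

/-- The image in the plane of the full subgraph of `Γ` spanned by the vertex set `W`. -/
def PlanarEmbedding.imageOf {V : Type*} {Γ : SimpleGraph V} (f : PlanarEmbedding Γ)
    (W : Set V) : Set (ℝ × ℝ) :=
  (f.vmap '' W) ∪ ⋃ (e : Sym2 V) (_ : e ∈ Γ.edgeSet) (_ : ∀ x ∈ e, x ∈ W), f.emap e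

/-- The 4-cycle `c` strongly separates the subgraph of `Γ` spanned by `W` with respect to the
embedding `f`: the image of the subgraph meets (at least) two distinct connected components of
the complement of the image of `c`. -/
def StronglySeparatesIn {V : Type*} {Γ : SimpleGraph V} (f : PlanarEmbedding Γ)
    (c : Fin 4 → V) (W : Set V) : Prop :=
  ∃ x y : ℝ × ℝ, x ∈ f.imageOf W ∧ y ∈ f.imageOf W ∧
    x ∉ f.imageOf (Set.range c) ∧ y ∉ f.imageOf (Set.range c) ∧
    y ∉ connectedComponentIn (f.imageOf (Set.range c))ᶜ x

/-- `(W₁, W₂)` is a strong visual decomposition of `Γ` along the induced 4-cycle `c`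
with respect to the embedding `f`. -/
def StrongVisualDecomposition {V : Type*} {Γ : SimpleGraph V} (f : PlanarEmbedding Γ)
    (c : Fin 4 → V) (W₁ W₂ : Set V) : Prop :=
  IsInducedFourCycle Γ c ∧
  W₁ ∪ W₂ = Set.univ ∧ W₁ ∩ W₂ = Set.range c ∧
  (W₁ \ Set.range c).Nonempty ∧ (W₂ \ Set.range c).Nonempty ∧
  (∀ v ∈ W₁ \ Set.range c, ∀ w ∈ W₂ \ Set.range c,
    f.vmap w ∉ connectedComponentIn (f.imageOf (Set.range c))ᶜ (f.vmap v)) ∧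
  (∀ u v : V, Γ.Adj u v → (u ∈ W₁ ∧ v ∈ W₁) ∨ (u ∈ W₂ ∧ v ∈ W₂))

/-- Standing Assumptions: connected, triangle-free, planar, at least five vertices,
no separating vertices or edges. -/
def StandingAssumptions {V : Type*} (Γ : SimpleGraph V) : Prop :=
  Γ.Connected ∧ Γ.CliqueFree 3 ∧ Nonempty (PlanarEmbedding Γ) ∧ 5 ≤ Nat.card V ∧
  (∀ v : V, (Γ.induce ({v}ᶜ : Set V)).Connected) ∧
  (∀ u v : V, Γ.Adj u v → (Γ.induce ({u, v}ᶜ : Set V)).Connected)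

/-- `Γ` contains (as a subgraph) a suspension of three distinct points. -/
def ContainsSuspThree {V : Type*} (Γ : SimpleGraph V) : Prop :=
  ∃ (a : Fin 3 → V) (b : Fin 2 → V), Function.Injective a ∧ Function.Injective b ∧
    (∀ i j, a i ≠ b j) ∧ ∀ i j, Γ.Adj (a i) (b j)

/-- `Γ` is (exactly) the suspension of three distinct points. -/
def IsSuspensionOfThreePoints {V : Type*} (Γ : SimpleGraph V) : Prop :=
  ∃ (a : Fin 3 → V) (b : Fin 2 → V), Function.Injective a ∧ Function.Injective b ∧
    (∀ i j, a i ≠ b j) ∧ Set.range a ∪ Set.range b = Set.univ ∧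
    ∀ x y : V, Γ.Adj x y ↔ ((∃ i j, x = a i ∧ y = b j) ∨ (∃ i j, x = b j ∧ y = a i))

/-- `Γ` is a suspension of a set of distinct (pairwise non-adjacent) vertices. -/
def IsSuspension {V : Type*} (Γ : SimpleGraph V) : Prop :=
  ∃ b₁ b₂ : V, b₁ ≠ b₂ ∧ ¬ Γ.Adj b₁ b₂ ∧
    (∀ v, v ≠ b₁ → v ≠ b₂ → Γ.Adj v b₁ ∧ Γ.Adj v b₂) ∧
    (∀ u v, u ≠ b₁ → u ≠ b₂ → v ≠ b₁ → v ≠ b₂ → ¬ Γ.Adj u v)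

/-- `Γ` is a join of two nonempty subgraphs. -/
def IsJoin {V : Type*} (Γ : SimpleGraph V) : Prop :=
  ∃ A B : Set V, A.Nonempty ∧ B.Nonempty ∧ Disjoint A B ∧ A ∪ B = Set.univ ∧
    ∀ a ∈ A, ∀ b ∈ B, Γ.Adj a b

/-- `Γ` is prime: not a 4-cycle, and some planar embedding has no strongly separating
4-cycle. -/
def IsPrime {V : Type*} (Γ : SimpleGraph V) : Prop :=
  (¬ ∃ c : Fin 4 → V, IsInducedFourCycle Γ c ∧ Set.range c = Set.univ) ∧
  ∃ f : PlanarEmbedding Γ, ∀ c : Fin 4 → V, IsInducedFourCycle Γ c →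
    ¬ StronglySeparatesIn f c Set.univ

/-- The closed half-space model for 3-manifolds with boundary. -/
def HalfSpace3 : Set (Fin 3 → ℝ) := {y | 0 ≤ y 0}

/-- A topological 3-manifold, possibly with boundary. -/
def IsManifold3WithBoundary (M : Type*) [TopologicalSpace M] : Prop :=
  T2Space M ∧ SecondCountableTopology M ∧ ∀ x : M, ∃ U : Set M, IsOpen U ∧ x ∈ U ∧
    ∃ W : Set ↥HalfSpace3, IsOpen W ∧ Nonempty (↥U ≃ₜ ↥W)

/-- A compact 3-manifold foliated by circles (Seifert fibered, by Epstein's theorem). -/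
def SeifertLike (M : Type*) [TopologicalSpace M] : Prop :=
  IsManifold3WithBoundary M ∧ CompactSpace M ∧ Nonempty M ∧
  ∃ (B : Type) (_ : TopologicalSpace B) (p : M → B),
    Continuous p ∧ Function.Surjective p ∧ ∀ b : B, Nonempty (↥(p ⁻¹' {b}) ≃ₜ Circle)

abbrev Torus : Type := Circle × Circle

/-- A (non-geometric) graph manifold: a compact 3-manifold, not itself Seifert fibered,
which is a union of finitely many closed Seifert pieces meeting along disjoint unions of
tori. -/
def IsGraphManifold (M : Type*) [TopologicalSpace M] : Prop :=
  IsManifold3WithBoundary M ∧ CompactSpace M ∧ ¬ SeifertLike M ∧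
  ∃ (n : ℕ) (P : Fin n → Set M),
    (⋃ i, P i) = Set.univ ∧
    (∀ i, IsClosed (P i) ∧ SeifertLike ↥(P i)) ∧
    ∀ i j, i ≠ j → ∃ k : ℕ, Nonempty (↥(P i ∩ P j) ≃ₜ (Fin k × Torus))

/-- A pointed topological space. -/
structure PointedSpace where
  carrier : Type
  top : TopologicalSpace carrier
  pt : carrier

attribute [instance] PointedSpace.top

/-- `G` is virtually the fundamental group of a Seifert fibered 3-manifold. -/
def VirtuallySeifert (G : Type*) [Group G] : Prop :=
  ∃ H : Subgroup G, H.FiniteIndex ∧ ∃ X : PointedSpace,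
    SeifertLike X.carrier ∧ Nonempty (H ≃* FundamentalGroup X.carrier X.pt)

/-- `G` is virtually the fundamental group of a graph manifold. -/
def VirtuallyGraphManifold (G : Type*) [Group G] : Prop :=
  ∃ H : Subgroup G, H.FiniteIndex ∧ ∃ X : PointedSpace,
    IsGraphManifold X.carrier ∧ Nonempty (H ≃* FundamentalGroup X.carrier X.pt)

/-- A vertex-colored graph. -/
structure ColoredGraph (C : Type*) where
  V : Type
  graph : SimpleGraph V
  color : V → C

/-- A weak covering of colored graphs: a color-preserving graph homomorphism with the
edge-lifting property. -/
def WeakCovering {C : Type*} (Λ Λ' : ColoredGraph C) (f : Λ.V → Λ'.V) : Prop :=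
  (∀ v, Λ'.color (f v) = Λ.color v) ∧
  (∀ v w, Λ.graph.Adj v w → Λ'.graph.Adj (f v) (f w)) ∧
  (∀ v w', Λ'.graph.Adj (f v) w' → ∃ w, Λ.graph.Adj v w ∧ f w = w')

/-- Two colored graphs are bisimilar if they weakly cover a common colored graph. -/
def Bisimilar {C : Type*} (Λ₁ Λ₂ : ColoredGraph C) : Prop :=
  ∃ (Λ : ColoredGraph C) (f₁ : Λ₁.V → Λ.V) (f₂ : Λ₂.V → Λ.V),
    WeakCovering Λ₁ Λ f₁ ∧ WeakCovering Λ₂ Λ f₂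

/-- Isomorphism of colored graphs. -/
def ColoredIso {C : Type*} (Λ₁ Λ₂ : ColoredGraph C) : Prop :=
  ∃ e : Λ₁.V ≃ Λ₂.V, (∀ v, Λ₂.color (e v) = Λ₁.color v) ∧
    ∀ v w, Λ₁.graph.Adj v w ↔ Λ₂.graph.Adj (e v) (e w)
/-- A visual decomposition tree of a CFS graph `Γ` satisfying the Standing Assumptions:
a finite tree whose vertices carry suspension subgraphs `Γv t = susp(Av t)` (with the two
suspension points `pole1 t`, `pole2 t`), glued along induced 4-cycles. -/
structure VisualDecompTree (V : Type*) (Γ : SimpleGraph V) where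
  T : Type
  finite : Finite T
  tree : SimpleGraph T
  isTree : tree.IsTree
  Γv : T → Set V
  Av : T → Set V
  pole1 : T → V
  pole2 : T → V
  susp : ∀ t : T,
    pole1 t ≠ pole2 t ∧ ¬ Γ.Adj (pole1 t) (pole2 t) ∧
    Γv t = Av t ∪ {pole1 t, pole2 t} ∧ pole1 t ∉ Av t ∧ pole2 t ∉ Av t ∧
    (∀ a ∈ Av t, Γ.Adj a (pole1 t) ∧ Γ.Adj a (pole2 t)) ∧
    (∀ a ∈ Av t, ∀ b ∈ Av t, ¬ Γ.Adj a b)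
  three : ∀ t : T, 3 ≤ Nat.card (Av t)
  distinct : Function.Injective Γv
  covers : (⋃ t : T, Γv t) = Set.univ
  edges4 : ∀ t₁ t₂ : T, tree.Adj t₁ t₂ →
    Γv t₁ ∩ Γv t₂ = {pole1 t₁, pole2 t₁, pole1 t₂, pole2 t₂} ∧
    IsFourCycleSet Γ (Γv t₁ ∩ Γv t₂)
  nonedges : ∀ t₁ t₂ : T, t₁ ≠ t₂ → ¬ tree.Adj t₁ t₂ →
    ¬ IsFourCycleSet Γ (Γv t₁ ∩ Γv t₂)
  polesIn : ∀ t₁ t₂ : T, tree.Adj t₁ t₂ → pole1 t₁ ∈ Av t₂ ∧ pole2 t₁ ∈ Av t₂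

/-- The weight of a vertex of a visual decomposition tree. -/
noncomputable def VisualDecompTree.weight {V : Type*} {Γ : SimpleGraph V} (D : VisualDecompTree V Γ)
    (t : D.T) : ℕ := Nat.card (D.Av t)

/-- The degree of a vertex of a visual decomposition tree. -/
noncomputable def VisualDecompTree.degree {V : Type*} {Γ : SimpleGraph V} (D : VisualDecompTree V Γ)
    (t : D.T) : ℕ := Nat.card (D.tree.neighborSet t)

/-- A vertex is black if its weight strictly exceeds its degree (white otherwise). -/
def VisualDecompTree.Black {V : Type*} {Γ : SimpleGraph V} (D : VisualDecompTree V Γ)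
    (t : D.T) : Prop := D.degree t < D.weight t

/-- The visual decomposition tree as a colored graph (colored by the black/white property). -/
def VisualDecompTree.colored {V : Type*} {Γ : SimpleGraph V} (D : VisualDecompTree V Γ) :
    ColoredGraph Prop :=
  ⟨D.T, D.tree, fun t => D.Black t⟩


section WordMetric

variable {G : Type*} [Group G] {S : Set G}

lemma wordDist_mul_left (S : Set G) (k g h : G) :
    wordDist S (k * g) (k * h) = wordDist S g h := by
  simp [wordDist, mul_assoc]

lemma wordDist_le_length {g h : G} {w : List G} (hw : ∀ x ∈ w, x ∈ S ∨ x⁻¹ ∈ S)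
    (hp : g⁻¹ * h = w.prod) : wordDist S g h ≤ w.length :=
  Nat.sInf_le ⟨w, rfl, hw, hp⟩

lemma wordDist_self (S : Set G) (g : G) : wordDist S g g = 0 :=
  Nat.le_zero.1 (wordDist_le_length (w := []) (by simp) (by simp))

lemma exists_word (hS : Subgroup.closure S = ⊤) (g h : G) :
    ∃ w : List G, w.length = wordDist S g h ∧ (∀ x ∈ w, x ∈ S ∨ x⁻¹ ∈ S) ∧
      g⁻¹ * h = w.prod := by
  refine Nat.sInf_mem
    (s := {n | ∃ w : List G, w.length = n ∧ (∀ x ∈ w, x ∈ S ∨ x⁻¹ ∈ S) ∧ g⁻¹ * h = w.prod}) ?_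
  have hmem : g⁻¹ * h ∈ (Subgroup.closure S).toSubmonoid := by simp [hS]
  rw [Subgroup.closure_toSubmonoid] at hmem
  obtain ⟨w, hw, hp⟩ := Submonoid.exists_list_of_mem_closure hmem
  exact ⟨w.length, w, rfl, fun x hx => by simpa using hw x hx, hp.symm⟩

lemma wordDist_triangle (hS : Subgroup.closure S = ⊤) (x y z : G) :
    wordDist S x z ≤ wordDist S x y + wordDist S y z := by
  obtain ⟨w, hl, hw, hp⟩ := exists_word hS x y
  obtain ⟨w', hl', hw', hp'⟩ := exists_word hS y z
  rw [← hl, ← hl', ← List.length_append]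
  refine wordDist_le_length (fun a ha => ?_) ?_
  · rcases List.mem_append.1 ha with h | h
    exacts [hw a h, hw' a h]
  · rw [List.prod_append, ← hp, ← hp']
    group

lemma wordDist_comm (hS : Subgroup.closure S = ⊤) (x y : G) :
    wordDist S x y = wordDist S y x := by
  have key : ∀ x y : G, wordDist S y x ≤ wordDist S x y := by
    intro x y
    obtain ⟨w, hl, hw, hp⟩ := exists_word hS x y
    have : wordDist S y x ≤ ((w.map fun a => a⁻¹).reverse).length := by
      refine wordDist_le_length (fun a ha => ?_) ?_
      · simp only [List.mem_reverse, List.mem_map] at ha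
        obtain ⟨b, hb, rfl⟩ := ha
        simpa [or_comm] using hw b hb
      · rw [← List.prod_inv_reverse, ← hp]
        group
    simpa [hl] using this
  exact le_antisymm (key y x) (key x y)

lemma finite_ball (hS : Subgroup.closure S = ⊤) (hfin : S.Finite) (n : ℕ) :
    {x : G | wordDist S 1 x ≤ n}.Finite := by
  have : Finite ↥(S ∪ S⁻¹) := (hfin.union hfin.inv).to_subtype
  refine ((List.finite_length_le ↥(S ∪ S⁻¹) n).image
    fun l => (l.map Subtype.val).prod).subset ?_
  intro x hx
  obtain ⟨w, hl, hw, hp⟩ := exists_word hS 1 x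
  refine ⟨w.attachWith (· ∈ S ∪ S⁻¹) (fun a ha => by simpa using hw a ha), ?_, ?_⟩
  · simpa [hl] using hx
  · simp only [List.attachWith_map_subtype_val]
    simpa using hp.symm

/-- `f` restricted to `{0, …, n}` is 1-Lipschitz and expands distances by at least `1 / K`. -/
def IsTamePath (S : Set G) (K : ℕ) (f : ℕ → G) (n : ℕ) : Prop :=
  ∀ i j, i ≤ j → j ≤ n → wordDist S (f i) (f j) ≤ j - i ∧ j - i ≤ K * wordDist S (f i) (f j)

lemma IsTamePath.mono {K K' n : ℕ} {f : ℕ → G} (hf : IsTamePath S K f n) (hK : K ≤ K') :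
    IsTamePath S K' f n := fun i j hij hj =>
  ⟨(hf i j hij hj).1, (hf i j hij hj).2.trans (Nat.mul_le_mul_right _ hK)⟩

lemma IsTamePath.isQuasiGeodesic (hS : Subgroup.closure S = ⊤) {K n : ℕ} (hK : 1 ≤ K)
    {f : ℕ → G} (hf : IsTamePath S K f n) (k : G) :
    IsQuasiGeodesic S K 0 (fun i : Fin (n + 1) => k * f i) := by
  have hK0 : (0 : ℝ) < K := by exact_mod_cast hK
  have hK1 : (1 : ℝ) ≤ K := by exact_mod_cast hK
  have key : ∀ i j : ℕ, i ≤ j → j ≤ n →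
      (wordDist S (f i) (f j) : ℝ) ≤ K * |(i : ℝ) - j| + 0 ∧
        |(i : ℝ) - j| / K - 0 ≤ (wordDist S (f i) (f j) : ℝ) := by
    intro i j hij hj
    obtain ⟨h1, h2⟩ := hf i j hij hj
    have hij' : (i : ℝ) ≤ j := by exact_mod_cast hij
    have h1' : (wordDist S (f i) (f j) : ℝ) ≤ (j : ℝ) - i := by
      rw [← Nat.cast_sub hij]; exact_mod_cast h1
    have h2' : (j : ℝ) - i ≤ K * (wordDist S (f i) (f j) : ℝ) := by
      rw [← Nat.cast_sub hij]; exact_mod_cast h2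
    rw [abs_sub_comm, abs_of_nonneg (sub_nonneg.2 hij'), sub_zero, add_zero, div_le_iff₀ hK0]
    exact ⟨by nlinarith, by linarith⟩
  intro i j
  simp only [wordDist_mul_left]
  rcases le_total (i : ℕ) (j : ℕ) with h | h
  · exact key i j h (by omega)
  · rw [wordDist_comm hS, abs_sub_comm]
    exact key j i h (by omega)

lemma exists_geodesic (hS : Subgroup.closure S = ⊤) (g h : G) :
    ∃ f : ℕ → G, f 0 = g ∧ f (wordDist S g h) = h ∧ IsTamePath S 1 f (wordDist S g h) := by
  obtain ⟨w, hl, hw, hp⟩ := exists_word hS g h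
  have hupper : ∀ i j, i ≤ j →
      wordDist S (g * (w.take i).prod) (g * (w.take j).prod) ≤ j - i := by
    intro i j hij
    rw [wordDist_mul_left]
    refine (wordDist_le_length (w := (w.take j).drop i)
      (fun x hx => hw x (List.mem_of_mem_take (List.mem_of_mem_drop hx))) ?_).trans ?_
    · rw [inv_mul_eq_iff_eq_mul]
      conv_lhs => rw [← List.take_append_drop i (w.take j)]
      rw [List.prod_append, List.take_take, min_eq_left hij]
    · simp only [List.length_drop, List.length_take]
      omega
  have hend : g * (w.take (wordDist S g h)).prod = h := by
    rw [← hl, List.take_length, ← hp]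
    group
  refine ⟨fun i => g * (w.take i).prod, by simp, hend, fun i j hij hj => ⟨hupper i j hij, ?_⟩⟩
  have h1 := hupper 0 i (Nat.zero_le _)
  have h2 := hupper j _ hj
  rw [hend] at h2
  simp only [List.take_zero, List.prod_nil, mul_one] at h1
  have h3 := wordDist_triangle hS g (g * (w.take i).prod) h
  have h4 := wordDist_triangle hS (g * (w.take i).prod) (g * (w.take j).prod) h
  simp only [one_mul]
  omega

lemma IsTamePath.append {K a b : ℕ} {f g : ℕ → G} (hf : IsTamePath S K f a)
    (hg : IsTamePath S K g b) (hfg : f a = g 0)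
    (hupper : ∀ i ≤ a, ∀ j ≤ b, wordDist S (f i) (g j) ≤ (a - i) + j)
    (hlower : ∀ i ≤ a, ∀ j ≤ b, (a - i) + j ≤ K * wordDist S (f i) (g j)) :
    ∃ h : ℕ → G, IsTamePath S K h (a + b) ∧ (∀ i ≤ a, h i = f i) ∧
      ∀ j ≤ b, h (a + j) = g j := by
  have hl : ∀ i ≤ a, (if i ≤ a then f i else g (i - a)) = f i := fun i hi => if_pos hi
  have hr : ∀ j, (if a + j ≤ a then f (a + j) else g (a + j - a)) = g j := by
    intro j
    rcases Nat.eq_zero_or_pos j with rfl | hj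
    · simpa using hfg
    · rw [if_neg (by omega), Nat.add_sub_cancel_left]
  refine ⟨fun i => if i ≤ a then f i else g (i - a), ?_, hl, fun j _ => hr j⟩
  intro i j hij hj
  rcases le_or_gt j a with hja | hja
  · simp only [hl i (hij.trans hja), hl j hja]
    exact hf i j hij hja
  · obtain ⟨j, rfl⟩ := Nat.exists_eq_add_of_le hja.le
    rcases le_or_gt i a with hia | hia
    · simp only [hl i hia, hr j]
      have := hupper i hia j (by omega)
      have := hlower i hia j (by omega)
      omega
    · obtain ⟨i, rfl⟩ := Nat.exists_eq_add_of_le hia.le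
      simp only [hr]
      have := hg i j (by omega) (by omega)
      omega

/-- A point of `X` and a point of a geodesic `γ`, chosen to be close to each other and to the
origin of `γ`, such that a geodesic between them leaves `γ` at a definite angle. -/
lemma exists_near_projection (hS : Subgroup.closure S = ⊤) {γ : ℕ → G} {L D : ℕ}
    (hγ : IsTamePath S 1 γ L) {X : Set G} {x₀ : G} (hx₀ : x₀ ∈ X)
    (hD : wordDist S x₀ (γ 0) ≤ D) :
    ∃ p ∈ X, ∃ s ≤ L, 2 * wordDist S p (γ s) + s ≤ 2 * D ∧
      ∀ u t, wordDist S p u + wordDist S u (γ s) = wordDist S p (γ s) → s ≤ t → t ≤ L →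
        wordDist S u (γ s) ≤ 3 * wordDist S u (γ t) := by
  obtain ⟨⟨p, s⟩, ⟨hp, hs⟩, hmin⟩ := exists_minimalFor_of_wellFoundedLT
    (fun z : G × ℕ => z.1 ∈ X ∧ z.2 ≤ L) (fun z => 2 * wordDist S z.1 (γ z.2) + z.2)
    ⟨(x₀, 0), hx₀, Nat.zero_le L⟩
  have hmin' : ∀ y t, y ∈ X → t ≤ L →
      2 * wordDist S p (γ s) + s ≤ 2 * wordDist S y (γ t) + t := by
    intro y t hy ht
    rcases le_total (2 * wordDist S p (γ s) + s) (2 * wordDist S y (γ t) + t) with h | h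
    · exact h
    · exact hmin (j := (y, t)) ⟨hy, ht⟩ h
  refine ⟨p, hp, s, hs, ?_, fun u t hu hst ht => ?_⟩
  · have := hmin' x₀ 0 hx₀ (Nat.zero_le L)
    omega
  · have h1 := hmin' p t hp ht
    have h2 := wordDist_triangle hS p u (γ t)
    have h3 := wordDist_triangle hS (γ s) u (γ t)
    have h4 := hγ s t hst ht
    have h5 := wordDist_comm hS u (γ s)
    omega

/-- If both ends of a long geodesic `γ` are close to `X`, then some quasi-geodesic with uniform
constants and endpoints in `X` contains the midpoint of `γ`. -/
lemma exists_tamePath_through_midpoint (hS : Subgroup.closure S = ⊤) {γ : ℕ → G} {L D : ℕ}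
    (hγ : IsTamePath S 1 γ L) (hL : 8 * D ≤ L) {X : Set G} {x₀ x₁ : G} (hx₀ : x₀ ∈ X)
    (hx₁ : x₁ ∈ X) (hD₀ : wordDist S x₀ (γ 0) ≤ D) (hD₁ : wordDist S x₁ (γ L) ≤ D) :
    ∃ (n : ℕ) (f : ℕ → G), IsTamePath S 7 f n ∧ f 0 ∈ X ∧ f n ∈ X ∧
      ∃ k ≤ n, f k = γ (L / 2) := by
  have hrev : IsTamePath S 1 (fun i => γ (L - i)) L := by
    intro i j hij hj
    have := hγ (L - j) (L - i) (by omega) (by omega)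
    rw [wordDist_comm hS]
    dsimp only
    omega
  obtain ⟨p, hp, s, hs, hps, hp'⟩ := exists_near_projection hS hγ hx₀ hD₀
  obtain ⟨q, hq, r, hr, hqr, hq'⟩ := exists_near_projection hS hrev hx₁ (by simpa using hD₁)
  obtain ⟨t, rfl⟩ : ∃ t, L = t + r := ⟨L - r, by omega⟩
  simp only [Nat.add_sub_cancel] at hqr hq'
  obtain ⟨α, hα0, hα1, hα⟩ := exists_geodesic hS p (γ s)
  obtain ⟨β, hβ0, hβ1, hβ⟩ := exists_geodesic hS (γ t) q
  set a := wordDist S p (γ s) with ha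
  set c := wordDist S (γ t) q with hc
  have hc' : wordDist S q (γ t) = c := wordDist_comm hS _ _
  have hst : s ≤ t := by omega
  have hmid : IsTamePath S 1 (fun i => γ (s + i)) (t - s) := by
    intro i j hij hj
    have := hγ (s + i) (s + j) (by omega) (by omega)
    dsimp only
    omega
  have hαd : ∀ i ≤ a, wordDist S p (α i) = i ∧ wordDist S (α i) (γ s) = a - i := by
    intro i hi
    have h1 := hα 0 i (Nat.zero_le _) hi
    have h2 := hα i a hi le_rfl
    rw [hα0] at h1
    rw [hα1] at h2
    omega
  have hβd : ∀ i ≤ c, wordDist S (γ t) (β i) = i ∧ wordDist S (β i) q = c - i := by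
    intro i hi
    have h1 := hβ 0 i (Nat.zero_le _) hi
    have h2 := hβ i c hi le_rfl
    rw [hβ0] at h1
    rw [hβ1] at h2
    omega
  obtain ⟨f, hf, hfα, hfγ⟩ := (hα.mono (K' := 7) (by norm_num)).append
    (hmid.mono (K' := 7) (by norm_num)) (by simpa using hα1)
    (fun i hi j hj => by
      have h1 := hγ s (s + j) (by omega) (by omega)
      have h2 := (hαd i hi).2
      have h3 := wordDist_triangle hS (α i) (γ s) (γ (s + j))
      omega)
    (fun i hi j hj => by
      have h1 := hγ s (s + j) (by omega) (by omega)
      have h2 := hαd i hi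
      have h3 := wordDist_triangle hS (γ s) (α i) (γ (s + j))
      have h4 := wordDist_comm hS (γ s) (α i)
      have h5 := hp' (α i) (s + j) (by omega) (by omega) (by omega)
      omega)
  have hfn : f (a + (t - s)) = γ t := by
    rw [hfγ _ le_rfl]
    congr 1
    omega
  obtain ⟨h, hh, hhf, hhβ⟩ := hf.append (hβ.mono (K' := 7) (by norm_num)) (by rw [hfn, hβ0])
    (fun i hi j hj => by
      have h1 := (hf i _ hi le_rfl).1
      rw [hfn] at h1
      have h2 := (hβd j hj).1
      have h3 := wordDist_triangle hS (f i) (γ t) (β j)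
      omega)
    (fun i hi j hj => by
      have h2 := hβd j hj
      rcases le_total i a with hia | hia
      · rw [hfα i hia]
        have h1 := hαd i hia
        have h3 := hγ s t hst (by omega)
        have h4 := wordDist_triangle hS (γ s) (α i) (γ t)
        have h5 := wordDist_triangle hS (α i) (β j) (γ t)
        have h6 := wordDist_comm hS (γ s) (α i)
        have h7 := wordDist_comm hS (β j) (γ t)
        omega
      · obtain ⟨k, rfl⟩ := Nat.exists_eq_add_of_le hia
        rw [hfγ k (by omega)]
        have h1 := hγ (s + k) t (by omega) (by omega)
        have h3 := wordDist_triangle hS (γ (s + k)) (β j) (γ t)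
        have h4 := wordDist_comm hS (β j) (γ t)
        have h5 := wordDist_comm hS (β j) (γ (s + k))
        have h6 := wordDist_comm hS (β j) q
        have h7 := hq' (β j) (t + r - (s + k)) (by omega) (by omega) (by omega)
        rw [show t + r - (t + r - (s + k)) = s + k by omega] at h7
        omega)
  refine ⟨_, h, hh, ?_, ?_, a + ((t + r) / 2 - s), by omega, ?_⟩
  · rwa [hhf 0 (by omega), hfα 0 (by omega), hα0]
  · rwa [hhβ c le_rfl, hβ1]
  · rw [hhf _ (by omega), hfγ _ (by omega)]
    congr 1
    omega

end WordMetric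

section FiniteHeight

variable {G : Type*} [Group G] {S : Set G} {H : Subgroup G}

lemma mem_stabilizer_mk {g x : G} :
    x ∈ MulAction.stabilizer G (g : G ⧸ H) ↔ g⁻¹ * x * g ∈ H := by
  rw [MulAction.mem_stabilizer_iff, MulAction.Quotient.smul_coe, smul_eq_mul, eq_comm,
    QuotientGroup.eq, mul_assoc]

/-- Strongly quasiconvex subgroups have finite height. -/
theorem StronglyQuasiconvex.exists_height (hS : Subgroup.closure S = ⊤) (hfin : S.Finite)
    (hsqc : StronglyQuasiconvex S (H : Set G)) :
    ∃ N : ℕ, ∀ Q : Finset (G ⧸ H), N < Q.card →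
      {x : G | ∀ c ∈ Q, x ∈ MulAction.stabilizer G c}.Finite := by
  classical
  obtain ⟨M, hM⟩ := hsqc 7 0 (by norm_num) le_rfl
  have hF := finite_ball hS hfin ⌊M⌋₊
  refine ⟨hF.toFinset.card, fun Q hQ => ?_⟩
  set D := Q.sup fun c => wordDist S 1 c.out
  refine (finite_ball hS hfin (8 * D)).subset fun b hb => ?_
  by_contra hlong
  simp only [mem_ofPred_eq, not_le] at hlong hb
  obtain ⟨γ, hγ0, hγ1, hγ⟩ := exists_geodesic hS 1 b
  set L := wordDist S 1 b
  refine hQ.not_ge ((Finset.card_le_card (t := hF.toFinset.image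
    fun x => ((γ (L / 2) * x : G) : G ⧸ H)) fun c hc => ?_).trans Finset.card_image_le)
  have hcD : wordDist S 1 c.out ≤ D := Finset.le_sup (f := fun c => wordDist S 1 c.out) hc
  have hbc : c.out⁻¹ * b * c.out ∈ H := by
    rw [← mem_stabilizer_mk, QuotientGroup.out_eq']
    exact hb c hc
  obtain ⟨n, f, hf, hf0, hfn, k, hk, hfk⟩ := exists_tamePath_through_midpoint hS hγ hlong.le
    (X := {x | c.out⁻¹ * x ∈ H}) (x₀ := c.out) (x₁ := b * c.out)
    (by simp) (by simpa [mul_assoc] using hbc)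
    (by rwa [hγ0, wordDist_comm hS])
    (by rw [hγ1, wordDist_comm hS]; simpa [wordDist_mul_left] using
          (wordDist_mul_left S b 1 c.out).trans_le hcD)
  obtain ⟨h, hh, hd⟩ := hM n (fun i => c.out⁻¹ * f i) (by simpa using hf0) (by simpa using hfn)
    (by exact_mod_cast hf.isQuasiGeodesic hS (by norm_num) c.out⁻¹) ⟨k, by omega⟩
  simp only [hfk] at hd
  have hd' := Nat.le_floor hd
  refine Finset.mem_image.2 ⟨(γ (L / 2))⁻¹ * (c.out * h), ?_, ?_⟩
  · rw [hF.mem_toFinset, mem_ofPred_eq, ← wordDist_mul_left S (c.out⁻¹ * γ (L / 2))]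
    simpa [mul_assoc] using hd'
  · rw [mul_inv_cancel_left, QuotientGroup.mk_mul_of_mem _ hh, QuotientGroup.out_eq']

/-- The trace of a conjugate of a strongly quasiconvex subgroup on an undistorted subgroup is
strongly quasiconvex. -/
theorem StronglyQuasiconvex.subgroupOf_stabilizer (hS : Subgroup.closure S = ⊤)
    (hfin : S.Finite) (hsqc : StronglyQuasiconvex S (H : Set G)) {A : Subgroup G} {T : Set A}
    (hA : Undistorted S A T) (g : G) :
    StronglyQuasiconvex T
      ((MulAction.stabilizer G (g : G ⧸ H)).subgroupOf A : Set A) := by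
  obtain ⟨K₁, C₁, hK₁, hC₁, hA⟩ := hA
  intro K C hK hC
  set D := wordDist S 1 g with hD
  have hconj : ∀ x y : G, wordDist S (g⁻¹ * x * g) (g⁻¹ * y * g) ≤ wordDist S x y + 2 * D ∧
      wordDist S x y ≤ wordDist S (g⁻¹ * x * g) (g⁻¹ * y * g) + 2 * D := by
    intro x y
    have hx : ∀ x, wordDist S x (x * g) = D := fun x => by
      simpa using wordDist_mul_left S x 1 g
    simp only [mul_assoc, wordDist_mul_left]
    have h1 := wordDist_triangle hS (x * g) x (y * g)
    have h2 := wordDist_triangle hS x y (y * g)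
    have h3 := wordDist_triangle hS x (x * g) y
    have h4 := wordDist_triangle hS (x * g) (y * g) y
    rw [wordDist_comm hS (x * g) x, hx] at h1
    rw [wordDist_comm hS (y * g) y, hx] at h4
    rw [hx] at h2 h3
    omega
  have hK₁' : 0 < K₁ := by linarith
  have hK' : 0 < K := by linarith
  obtain ⟨M, hM⟩ := hsqc (K₁ * K) (K₁ * C + C₁ + 2 * D) (by nlinarith) (by positivity)
  have hF := finite_ball hS hfin ⌊M⌋₊
  have hret : ∀ u : G, ∃ a : A, (∃ a' : A, g⁻¹ * a' * g * u ∈ H) → g⁻¹ * a * g * u ∈ H := by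
    intro u
    by_cases h : ∃ a' : A, g⁻¹ * a' * g * u ∈ H
    · exact ⟨h.choose, fun _ => h.choose_spec⟩
    · exact ⟨1, fun h' => absurd h' h⟩
  choose a ha using hret
  refine ⟨(hF.toFinset.sup fun u => wordDist T 1 (a u)⁻¹ : ℕ), fun n q hq0 hqn hq i => ?_⟩
  have hq' : IsQuasiGeodesic S (K₁ * K) (K₁ * C + C₁ + 2 * D)
      (fun i => g⁻¹ * (q i : G) * g) := by
    intro i j
    obtain ⟨h1, h2⟩ := hq i j
    obtain ⟨h3, h4⟩ := hA (q i) (q j)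
    obtain ⟨h5, h6⟩ := hconj (q i) (q j)
    have h5' : (wordDist S (g⁻¹ * (q i : G) * g) (g⁻¹ * (q j : G) * g) : ℝ) ≤
        wordDist S (q i : G) (q j) + 2 * D := by exact_mod_cast h5
    have h6' : (wordDist S (q i : G) (q j) : ℝ) ≤
        wordDist S (g⁻¹ * (q i : G) * g) (g⁻¹ * (q j : G) * g) + 2 * D := by exact_mod_cast h6
    set e := |((i : ℕ) : ℝ) - ((j : ℕ) : ℝ)|
    constructor
    · have := mul_le_mul_of_nonneg_left h1 hK₁'.le
      dsimp only
      nlinarith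
    · have h7 : e / K ≤ K₁ * (wordDist S (q i : G) (q j) + (C + C₁)) := by nlinarith
      have h8 : e / (K₁ * K) ≤ wordDist S (q i : G) (q j) + (C + C₁) := by
        rw [mul_comm, ← div_div, div_le_iff₀ hK₁']
        linarith
      dsimp only
      nlinarith
  obtain ⟨h, hh, hd⟩ := hM n _ (mem_stabilizer_mk.1 hq0) (mem_stabilizer_mk.1 hqn) hq' i
  set u := (g⁻¹ * (q i : G) * g)⁻¹ * h with hu
  have huF : u ∈ hF.toFinset := by
    rw [hF.mem_toFinset, mem_ofPred_eq, ← wordDist_mul_left S (g⁻¹ * (q i : G) * g)]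
    rw [hu, mul_one, mul_inv_cancel_left]
    exact Nat.le_floor hd
  have hqu : g⁻¹ * (q i : G) * g * u ∈ H := by rwa [hu, mul_inv_cancel_left]
  refine ⟨q i * (a u)⁻¹, ?_, ?_⟩
  · refine mem_stabilizer_mk.2 ?_
    have := H.mul_mem hqu (H.inv_mem (ha u ⟨q i, hqu⟩))
    convert this using 1
    simp only [Subgroup.coe_subtype, Subgroup.coe_mul, Subgroup.coe_inv]
    group
  · have h1 := wordDist_mul_left T (q i) 1 (a u)⁻¹
    rw [mul_one] at h1
    rw [h1]
    exact_mod_cast Finset.le_sup (f := fun u => wordDist T 1 (a u)⁻¹) huF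

lemma infinite_inf_of_relIndex_ne_zero {K A : Subgroup G} (h : K.relIndex A ≠ 0)
    (hA : (A : Set G).Infinite) : ((K ⊓ A : Subgroup G) : Set G).Infinite := by
  intro hfin
  have hc : Nat.card A = 0 := by
    have := hA.to_subtype
    exact Nat.card_eq_zero_of_infinite
  have : Finite ((K ⊓ A : Subgroup G) : Set G) := hfin.to_subtype
  have hf : Finite (K.subgroupOf A) := by
    refine Finite.of_injective (β := ((K ⊓ A : Subgroup G) : Set G))
      (fun x => ⟨x.1.1, Subgroup.mem_subgroupOf.1 x.2, x.1.2⟩) fun x y hxy => ?_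
    exact Subtype.ext (Subtype.ext (Subtype.mk.inj hxy))
  exact mul_ne_zero Nat.card_pos.ne' h ((K.subgroupOf A).card_mul_index.trans hc)

end FiniteHeight

/-- `G` decomposes as a finite graph of groups (encoded by its action on the
Bass–Serre tree `T` with finitely many orbits) in which every vertex group (= vertex
stabilizer) is finitely generated, undistorted, and has all its strongly quasiconvex infinite
subgroups of finite index, and every edge group is infinite. If `H` is a strongly quasiconvex
subgroup of infinite index, then `gHg⁻¹ ∩ G_v` is finite for every vertex group and every
`g ∈ G`. -/
theorem stmt_4 {G V : Type} [Group G] [MulAction G V] (S : Finset G)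
    (hS : Subgroup.closure (S : Set G) = ⊤)
    (T : SimpleGraph V) (hT : T.IsTree) (hact : ActsOnGraph G T)
    (hfin : Finite (Quotient (MulAction.orbitRel G V)))
    (hvert : ∀ v : V, ∃ Sv : Finset (MulAction.stabilizer G v),
      Subgroup.closure (Sv : Set (MulAction.stabilizer G v)) = ⊤ ∧
      Undistorted (S : Set G) (MulAction.stabilizer G v)
        (Sv : Set (MulAction.stabilizer G v)) ∧
      ∀ K : Subgroup (MulAction.stabilizer G v),
        StronglyQuasiconvex (Sv : Set (MulAction.stabilizer G v))
          (K : Set (MulAction.stabilizer G v)) →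
        (K : Set (MulAction.stabilizer G v)).Infinite → K.FiniteIndex)
    (hedge : ∀ v w : V, T.Adj v w →
      ((MulAction.stabilizer G v ⊓ MulAction.stabilizer G w : Subgroup G) : Set G).Infinite)
    (H : Subgroup G)
    (hsqc : StronglyQuasiconvex (S : Set G) (H : Set G))
    (hHi : ¬ H.FiniteIndex) :
    ∀ (g : G) (v : V), {x : G | x ∈ MulAction.stabilizer G v ∧ g⁻¹ * x * g ∈ H}.Finite := by
  intro g v
  by_contra hinf
  have hstab : ∀ (k : G) (w : V),
      ((MulAction.stabilizer G (k : G ⧸ H) ⊓ MulAction.stabilizer G w : Subgroup G) :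
        Set G).Infinite →
      (MulAction.stabilizer G (k : G ⧸ H)).relIndex (MulAction.stabilizer G w) ≠ 0 := by
    intro k w hk
    obtain ⟨T', -, hund, hfi⟩ := hvert w
    refine (hfi _ (hsqc.subgroupOf_stabilizer hS S.finite_toSet hund k) ?_).index_ne_zero
    intro hf
    refine hk ((hf.image Subtype.val).subset ?_)
    rintro x ⟨hx, hx'⟩
    exact ⟨⟨x, hx'⟩, hx, rfl⟩
  have hall : ∀ w : V, ((MulAction.stabilizer G (g : G ⧸ H) ⊓ MulAction.stabilizer G w :
      Subgroup G) : Set G).Infinite := by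
    intro w
    obtain ⟨p⟩ := hT.connected v w
    induction p with
    | nil =>
      refine fun hf => hinf (hf.subset ?_)
      exact fun x hx => ⟨mem_stabilizer_mk.2 hx.2, hx.1⟩
    | @cons x y z hxy p ih =>
      refine ih fun hf => ?_
      have hx : ((MulAction.stabilizer G (g : G ⧸ H) ⊓ MulAction.stabilizer G x :
          Subgroup G) : Set G).Infinite :=
        fun hf' => hinf (hf'.subset fun x hx => ⟨mem_stabilizer_mk.2 hx.2, hx.1⟩)
      refine infinite_inf_of_relIndex_ne_zero
        (fun h0 => hstab g x hx (Subgroup.relIndex_eq_zero_of_le_right inf_le_left h0))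
        (hedge x y hxy) (hf.subset ?_)
      exact fun a ha => ⟨ha.2.2, mem_stabilizer_mk.1 ha.1⟩
  have hconj : ∀ k : G,
      (MulAction.stabilizer G (k : G ⧸ H)).relIndex (MulAction.stabilizer G v) ≠ 0 := by
    intro k
    refine hstab k v fun hf => hall ((g * k⁻¹) • v) ?_
    refine (hf.image fun x => (g * k⁻¹) * x * (g * k⁻¹)⁻¹).subset ?_
    rintro x ⟨hx, hx'⟩
    refine ⟨(g * k⁻¹)⁻¹ * x * (g * k⁻¹), ⟨?_, ?_⟩, by group⟩
    · refine mem_stabilizer_mk.2 ?_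
      convert mem_stabilizer_mk.1 hx using 1
      group
    · have hfix : x • (g * k⁻¹) • v = (g * k⁻¹) • v := hx'
      refine MulAction.mem_stabilizer_iff.2 ?_
      rw [mul_smul, mul_smul, hfix, inv_smul_smul]
  have hinfv : (MulAction.stabilizer G v : Set G).Infinite :=
    (hall v).mono fun x hx => hx.2
  obtain ⟨N, hN⟩ := hsqc.exists_height hS S.finite_toSet
  have : Infinite (G ⧸ H) := by
    rw [← Subgroup.index_eq_zero_iff_infinite]
    by_contra h0
    exact hHi ⟨h0⟩
  obtain ⟨Q, hQ⟩ := Infinite.exists_subset_card_eq (G ⧸ H) (N + 1)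
  refine infinite_inf_of_relIndex_ne_zero (K := ⨅ c : Q, MulAction.stabilizer G (c : G ⧸ H))
    (Subgroup.relIndex_iInf_ne_zero fun c => ?_) hinfv ((hN Q (by omega)).subset ?_)
  · rw [← QuotientGroup.out_eq' (c : G ⧸ H)]
    exact hconj _
  · rintro x ⟨hx, -⟩ c hc
    exact (Subgroup.mem_iInf.1 hx) ⟨c, hc⟩

end Paper
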